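/- Let μ ∈ D(P_RCCS) be a distribution, L ⊆ N a finite set of channels containing all channels occurring in μ, and b ∈ N ∖ L a fresh channel. Define Q = Σ_{a∈L} a.0 + Σ_{a∈L} ā.0 + b.0 and μ^L = (L)(μ | δ_Q). Then χmay_𝓛(μ) + χfair_𝓛(μ^L) = 1. -/

import Mathlib

open scoped Classical

/-! ## Channels, actions, RCCS terms -/

/-- Channels, drawn from an infinite set. -/
abbrev Chan := ℕ

/-- Actions: input/output labels over channels, the silent action `τ`, and the
distinguished success action `ω` (used only by observers). -/
inductive Act where
  | inp : Chan → Act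
  | out : Chan → Act
  | tau : Act
  | omega : Act
deriving DecidableEq

/-- `α` is an external label, i.e. a member of `𝓛 = N ∪ N̄`. -/
def Act.IsLabel : Act → Prop
  | .inp _ => True
  | .out _ => True
  | _ => False

/-- Complementary labels (for communication). -/
def Act.Comp : Act → Act → Prop := fun x y =>
  ∃ a, (x = .inp a ∧ y = .out a) ∨ (x = .out a ∧ y = .inp a)

/-- `β, β̄ ∉ L`: the action is not blocked by the localization `(L)-`. -/
def Act.Allowed (L : Finset Chan) : Act → Prop
  | .inp a => a ∉ L
  | .out a => a ∉ L
  | _ => True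

/-- Channels occurring in an action. -/
def Act.chans : Act → Finset Chan
  | .inp a => {a}
  | .out a => {a}
  | _ => ∅

/-- RCCS (and RCCS^ω) terms, with de Bruijn indices for process variables.
`sum k acts conts` is the nondeterministic choice `Σ_{i∈I} α_i.T_i` over the
nonempty finite index set `I = Fin (k+1)`, and `oplus k w conts` is the
probabilistic choice `⊕_{i∈I} p_i τ.T_i`. `fix T` is `μX.T` (binding index 0). -/
inductive Tm where
  | nil : Tm
  | var : ℕ → Tm
  | sum : (k : ℕ) → (Fin (k+1) → Act) → (Fin (k+1) → Tm) → Tm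
  | oplus : (k : ℕ) → (Fin (k+1) → ℝ) → (Fin (k+1) → Tm) → Tm
  | par : Tm → Tm → Tm
  | loc : Finset Chan → Tm → Tm
  | fix : Tm → Tm

/-- Substitution `T{P/X}` of a (closed) term `P` for the de Bruijn variable `n`. -/
def Tm.subst (P : Tm) : ℕ → Tm → Tm
  | _, .nil => .nil
  | n, .var m => if m = n then P else .var m
  | n, .sum k a c => .sum k a (fun i => Tm.subst P n (c i))
  | n, .oplus k w c => .oplus k w (fun i => Tm.subst P n (c i))
  | n, .par S T => .par (Tm.subst P n S) (Tm.subst P n T)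
  | n, .loc L T => .loc L (Tm.subst P n T)
  | n, .fix T => .fix (Tm.subst P (n+1) T)

/-- `T` has all its free variables among the first `n` de Bruijn indices.
`ClosedAt 0 T` means `T` is closed; `ClosedAt 1 T` means at most one free variable. -/
def Tm.ClosedAt : ℕ → Tm → Prop
  | _, .nil => True
  | n, .var m => m < n
  | n, .sum _ _ c => ∀ i, Tm.ClosedAt n (c i)
  | n, .oplus _ _ c => ∀ i, Tm.ClosedAt n (c i)
  | n, .par S T => Tm.ClosedAt n S ∧ Tm.ClosedAt n T
  | n, .loc _ T => Tm.ClosedAt n T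
  | n, .fix T => Tm.ClosedAt (n+1) T

/-- The success action `ω` does not occur in `T` (so `T` is a genuine RCCS term). -/
def Tm.NoOmega : Tm → Prop
  | .nil => True
  | .var _ => True
  | .sum _ a c => (∀ i, a i ≠ Act.omega) ∧ (∀ i, Tm.NoOmega (c i))
  | .oplus _ _ c => ∀ i, Tm.NoOmega (c i)
  | .par S T => Tm.NoOmega S ∧ Tm.NoOmega T
  | .loc _ T => Tm.NoOmega T
  | .fix T => Tm.NoOmega T

/-- No probabilistic choice occurs in `T` (so `T` is a CCS term). -/
def Tm.NoOplus : Tm → Prop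
  | .nil => True
  | .var _ => True
  | .sum _ _ c => ∀ i, Tm.NoOplus (c i)
  | .oplus _ _ _ => False
  | .par S T => Tm.NoOplus S ∧ Tm.NoOplus T
  | .loc _ T => Tm.NoOplus T
  | .fix T => Tm.NoOplus T

/-- The channels `N(T)` occurring in a term. -/
def Tm.chans : Tm → Finset Chan
  | .nil => ∅
  | .var _ => ∅
  | .sum _ a c =>
      (Finset.univ.sup fun i => (a i).chans) ∪ (Finset.univ.sup fun i => Tm.chans (c i))
  | .oplus _ _ c => Finset.univ.sup fun i => Tm.chans (c i)
  | .par S T => S.chans ∪ T.chans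
  | .loc L T => L ∪ T.chans
  | .fix T => T.chans

/-- Renaming of channels in an action. -/
def Act.rename (f : Chan → Chan) : Act → Act
  | .inp a => .inp (f a)
  | .out a => .out (f a)
  | x => x

/-- Renaming `T[f]` of the global channels of a term (local channels are untouched). -/
def Tm.rename : (Chan → Chan) → Tm → Tm
  | _, .nil => .nil
  | _, .var m => .var m
  | f, .sum k a c => .sum k (fun i => (a i).rename f) (fun i => Tm.rename f (c i))
  | f, .oplus k w c => .oplus k w (fun i => Tm.rename f (c i))
  | f, .par S T => .par (Tm.rename f S) (Tm.rename f T)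
  | f, .loc L T => .loc L (Tm.rename (fun a => if a ∈ L then a else f a) T)
  | f, .fix T => .fix (Tm.rename f T)

/-- `P` is an RCCS process: closed and without the success action. -/
def Tm.IsProc (P : Tm) : Prop := Tm.ClosedAt 0 P ∧ Tm.NoOmega P

/-- `P` is a CCS process: a process without probabilistic choice. -/
def Tm.IsCCS (P : Tm) : Prop := P.IsProc ∧ Tm.NoOplus P

/-! ## Finitely supported distributions -/

/-- Finitely supported probability distributions on `α`. -/
structure FinDist (α : Type) where
  toFun : α → ℝ
  nonneg : ∀ a, 0 ≤ toFun a
  finite_support : (Function.support toFun).Finite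
  sum_one : ∑ᶠ a, toFun a = 1

namespace FinDist

/-- The probability `μ(φ)` that a predicate (set) `φ` holds under `μ`. -/
noncomputable def mass {α : Type} (μ : FinDist α) (φ : Set α) : ℝ :=
  ∑ᶠ a ∈ φ, μ.toFun a

/-- The Dirac distribution `δ_P`. -/
noncomputable def dirac {α : Type} (P : α) : FinDist α where
  toFun := fun Q => if Q = P then 1 else 0
  nonneg := by intro a; by_cases h : a = P <;> simp [h]
  finite_support := by
    apply Set.Finite.subset (Set.finite_singleton P)
    intro a ha
    by_contra h
    simp only [Set.mem_singleton_iff] at h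
    simp [Function.mem_support, h] at ha
  sum_one := by
    rw [finsum_eq_single _ P (fun b hb => by simp [hb])]
    simp

/-- Pushforward of a finitely supported distribution along a map. -/
noncomputable def map {α β : Type} (g : α → β) (μ : FinDist α) : FinDist β where
  toFun := fun b => ∑ᶠ a ∈ {a | g a = b}, μ.toFun a
  nonneg := by
    intro b
    exact finsum_nonneg fun a => finsum_nonneg fun _ => μ.nonneg a
  finite_support := by
    apply Set.Finite.subset (μ.finite_support.image g)
    intro b hb
    rw [Function.mem_support] at hb
    by_contra h
    apply hb
    apply finsum_mem_eq_zero_of_forall_eq_zero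
    intro a ha
    by_contra ha0
    exact h ⟨a, Function.mem_support.mpr ha0, ha⟩
  sum_one := by
    classical
    set s := μ.finite_support.toFinset with hs
    have hfib : ∀ b : β, (∑ᶠ a ∈ {a | g a = b}, μ.toFun a)
        = ∑ a ∈ s.filter (fun a => g a = b), μ.toFun a := by
      intro b
      apply finsum_mem_eq_sum_of_inter_support_eq
      ext a
      simp only [Set.mem_inter_iff, Set.mem_setOf_eq, Finset.coe_filter,
        Set.Finite.mem_toFinset, Function.mem_support, hs]
      tauto
    have hsub : Function.support (fun b : β => ∑ᶠ a ∈ {a | g a = b}, μ.toFun a) ⊆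
        ↑(s.image g) := by
      intro b hb
      rw [Function.mem_support, hfib] at hb
      obtain ⟨a, ha, hne⟩ := Finset.exists_ne_zero_of_sum_ne_zero hb
      rw [Finset.mem_filter] at ha
      simp only [Finset.coe_image, Set.mem_image, Finset.mem_coe]
      exact ⟨a, ha.1, ha.2⟩
    rw [finsum_eq_finset_sum_of_support_subset _ hsub]
    calc ∑ b ∈ s.image g, ∑ᶠ a ∈ {a | g a = b}, μ.toFun a
        = ∑ b ∈ s.image g, ∑ a ∈ s.filter (fun a => g a = b), μ.toFun a :=
          Finset.sum_congr rfl fun b _ => hfib b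
      _ = ∑ a ∈ s, μ.toFun a :=
          Finset.sum_fiberwise_of_maps_to (fun a ha => Finset.mem_image_of_mem g ha)
            μ.toFun
      _ = 1 := by rw [← finsum_eq_sum μ.toFun μ.finite_support]; exact μ.sum_one

/-- The product of two finitely supported distributions. -/
noncomputable def prod {α β : Type} (μ : FinDist α) (ν : FinDist β) :
    FinDist (α × β) where
  toFun := fun x => μ.toFun x.1 * ν.toFun x.2
  nonneg := fun x => mul_nonneg (μ.nonneg _) (ν.nonneg _)
  finite_support := by
    apply Set.Finite.subset (μ.finite_support.prod ν.finite_support)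
    intro x hx
    rw [Function.mem_support] at hx
    have h := mul_ne_zero_iff.mp hx
    exact ⟨Function.mem_support.mpr h.1, Function.mem_support.mpr h.2⟩
  sum_one := by
    classical
    have hsub : Function.support (fun x : α × β => μ.toFun x.1 * ν.toFun x.2) ⊆
        ↑(μ.finite_support.toFinset ×ˢ ν.finite_support.toFinset) := by
      intro x hx
      rw [Function.mem_support] at hx
      have h := mul_ne_zero_iff.mp hx
      simp only [Finset.coe_product, Set.mem_prod, Set.Finite.coe_toFinset]
      exact ⟨h.1, h.2⟩
    rw [finsum_eq_finset_sum_of_support_subset _ hsub, Finset.sum_product]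
    have h1 : ∑ a ∈ μ.finite_support.toFinset, μ.toFun a = 1 := by
      rw [← finsum_eq_sum μ.toFun μ.finite_support]; exact μ.sum_one
    have h2 : ∑ b ∈ ν.finite_support.toFinset, ν.toFun b = 1 := by
      rw [← finsum_eq_sum ν.toFun ν.finite_support]; exact ν.sum_one
    calc ∑ a ∈ μ.finite_support.toFinset, ∑ b ∈ ν.finite_support.toFinset,
          μ.toFun a * ν.toFun b
        = ∑ a ∈ μ.finite_support.toFinset, μ.toFun a * 1 := by
          refine Finset.sum_congr rfl fun a _ => ?_
          rw [← Finset.mul_sum, h2]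
      _ = 1 := by simpa using h1

/-- Parallel composition `μ | ν` of distributions:
`(μ|ν)(A|B) = μ(A)·ν(B)`. -/
noncomputable def parD (μ ν : FinDist Tm) : FinDist Tm :=
  (μ.prod ν).map fun x => Tm.par x.1 x.2

/-- Localization `(L)μ` of a distribution. -/
noncomputable def locD (L : Finset Chan) (μ : FinDist Tm) : FinDist Tm :=
  μ.map (Tm.loc L)

/-- Renaming `μ[f]` of a distribution. -/
noncomputable def renameD (f : Chan → Chan) (μ : FinDist Tm) : FinDist Tm :=
  μ.map (Tm.rename f)

/-- Instantiation `ϑ[P]` of a 1-ary distribution `ϑ` at the process `P`. -/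
noncomputable def instD (ϑ : FinDist Tm) (P : Tm) : FinDist Tm :=
  ϑ.map (fun T => Tm.subst P 0 T)

/-- Every element of the support is a process (`μ ∈ D(P_RCCS)`). -/
def IsProcDist (μ : FinDist Tm) : Prop := ∀ P, μ.toFun P ≠ 0 → P.IsProc

/-- All channels occurring in (the support of) `μ` lie in `L`. -/
def chansIn (μ : FinDist Tm) (L : Finset Chan) : Prop :=
  ∀ P, μ.toFun P ≠ 0 → P.chans ⊆ L

/-- The channel `a` occurs in (the support of) `μ`, i.e. `a ∈ N(μ)`. -/
def hasChan (μ : FinDist Tm) (a : Chan) : Prop := ∃ P, μ.toFun P ≠ 0 ∧ a ∈ P.chans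

end FinDist

/-! ## Part I: the probabilistic labelled transition system on processes -/

/-- Part I of the pLTS for RCCS (and RCCS^ω): `P →α ρ`. -/
inductive Step : Tm → Act → FinDist Tm → Prop where
  | choice {k : ℕ} (acts : Fin (k+1) → Act) (conts : Fin (k+1) → Tm) (i : Fin (k+1)) :
      Step (.sum k acts conts) (acts i) (FinDist.dirac (conts i))
  | oplus {k : ℕ} (w : Fin (k+1) → ℝ) (conts : Fin (k+1) → Tm) (ρ : FinDist Tm) :
      (∀ i, 0 < w i ∧ w i < 1) →
      (∀ Q, ρ.toFun Q = ∑ i, if conts i = Q then w i else 0) →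
      Step (.oplus k w conts) .tau ρ
  | parL {S : Tm} {α : Act} {ρ : FinDist Tm} (T : Tm) :
      Step S α ρ → Step (.par S T) α (ρ.parD (FinDist.dirac T))
  | parR {T : Tm} {α : Act} {ρ : FinDist Tm} (S : Tm) :
      Step T α ρ → Step (.par S T) α ((FinDist.dirac S).parD ρ)
  | comm {S T : Tm} {ℓ1 ℓ2 : Act} {ρ1 ρ2 : FinDist Tm} :
      Act.Comp ℓ1 ℓ2 → Step S ℓ1 ρ1 → Step T ℓ2 ρ2 →
      Step (.par S T) .tau (ρ1.parD ρ2)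
  | loc {T : Tm} {β : Act} {ρ : FinDist Tm} (L : Finset Chan) :
      Step T β ρ → Act.Allowed L β → Step (.loc L T) β (FinDist.locD L ρ)
  | fixp {T : Tm} {β : Act} {ρ : FinDist Tm} :
      Step (Tm.subst (.fix T) 0 T) β ρ → Step (.fix T) β ρ

/-! ## Part II: probabilistic transitions on distributions -/

/-- Part II of the pLTS: `μ →(α,p) ν` iff `0 < p ≤ 1` and there are `P ∈ supp μ`
and `ρ` with `P →α ρ` and `ν = μ + μ(P)·p·(ρ − δ_P)`. -/
def PStep (μ : FinDist Tm) (α : Act) (p : ℝ) (ν : FinDist Tm) : Prop :=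
  0 < p ∧ p ≤ 1 ∧
    ∃ P ρ, 0 < μ.toFun P ∧ Step P α ρ ∧
      ∀ Q, ν.toFun Q = μ.toFun Q + μ.toFun P * p * (ρ.toFun Q - (if Q = P then 1 else 0))

/-- Probabilistic transition sequence `μ →π ν` along a word `π`. -/
def PSeq : FinDist Tm → List (Act × ℝ) → FinDist Tm → Prop
  | μ, [], ν => ν = μ
  | μ, s :: π, ν => ∃ μ', PStep μ s.1 s.2 μ' ∧ PSeq μ' π ν

/-- Internal transition sequence `μ ⇝ ν`. -/
def Internal (μ ν : FinDist Tm) : Prop :=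
  ∃ π : List (Act × ℝ), (∀ s ∈ π, s.1 = Act.tau) ∧ PSeq μ π ν

/-! ## Observability predicates and testing characteristics -/

/-- `ψ_𝓛`: processes that can immediately perform an external action. -/
def psiL : Set Tm := {P | ∃ α ρ, Act.IsLabel α ∧ Step P α ρ}

/-- `ψ_ω`: processes that can immediately perform the success action `ω`. -/
def psiOmega : Set Tm := {P | ∃ ρ, Step P Act.omega ρ}

/-- The may characteristic `χmay_𝓛(μ) = sup { ν(ψ_𝓛) : μ ⇝ ν }`. -/
noncomputable def chiMayL (μ : FinDist Tm) : ℝ :=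
  sSup {x | ∃ ν, Internal μ ν ∧ x = ν.mass psiL}

/-- The fair characteristic `χfair_𝓛(μ) = inf { χmay_𝓛(ν) : μ ⇝ ν }`. -/
noncomputable def chiFairL (μ : FinDist Tm) : ℝ :=
  sInf {x | ∃ ν, Internal μ ν ∧ x = chiMayL ν}

/-- `χmay_ω(μ) = sup { ν(ψ_ω) : μ ⇝ ν }`. -/
noncomputable def chiMayOmega (μ : FinDist Tm) : ℝ :=
  sSup {x | ∃ ν, Internal μ ν ∧ x = ν.mass psiOmega}

/-- `χfair_ω(μ) = inf { χmay_ω(ν) : μ ⇝ ν }`. -/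
noncomputable def chiFairOmega (μ : FinDist Tm) : ℝ :=
  sInf {x | ∃ ν, Internal μ ν ∧ x = chiMayOmega ν}

/-! ## Testing contexts, equipollence, extensionality, diamond/box equivalences -/

/-- `Δ(P_CCS) ⊆ 𝒟 ⊆ D(P_RCCS)`, closed under parallel composition, localization
and (finite-domain) renaming. -/
structure IsTestingContext (D : Set (FinDist Tm)) : Prop where
  dirac_ccs : ∀ P : Tm, P.IsCCS → FinDist.dirac P ∈ D
  proc_dist : ∀ μ ∈ D, μ.IsProcDist
  closed_par : ∀ μ ∈ D, ∀ ν ∈ D, μ.parD ν ∈ D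
  closed_loc : ∀ μ ∈ D, ∀ L : Finset Chan, FinDist.locD L μ ∈ D
  closed_rename : ∀ μ ∈ D, ∀ f : Chan → Chan, {a | f a ≠ a}.Finite →
      FinDist.renameD f μ ∈ D

/-- `R` is probabilistically equipollent. -/
def Equipollent (R : FinDist Tm → FinDist Tm → Prop) : Prop :=
  ∀ μ1 μ2, R μ1 μ2 → chiMayL μ1 = chiMayL μ2

/-- `R` is probabilistically strongly equipollent. -/
def StronglyEquipollent (R : FinDist Tm → FinDist Tm → Prop) : Prop :=
  ∀ μ1 μ2, R μ1 μ2 → chiFairL μ1 = chiFairL μ2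

/-- `R` is `𝒟`-extensional. -/
def DExtensional (D : Set (FinDist Tm)) (R : FinDist Tm → FinDist Tm → Prop) : Prop :=
  ∀ μ1 μ2, R μ1 μ2 →
    (∀ ν ∈ D, R (μ1.parD ν) (μ2.parD ν)) ∧
    (∀ L : Finset Chan, R (FinDist.locD L μ1) (FinDist.locD L μ2))

/-- The `𝒟`-diamond equivalence `=◇^𝒟`, the largest probabilistically equipollent
`𝒟`-extensional relation. -/
def DiamondEq (D : Set (FinDist Tm)) (μ1 μ2 : FinDist Tm) : Prop :=
  ∃ R, Equipollent R ∧ DExtensional D R ∧ R μ1 μ2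

/-- The `𝒟`-box equivalence `=□^𝒟`, the largest probabilistically strongly
equipollent `𝒟`-extensional relation. -/
def BoxEq (D : Set (FinDist Tm)) (μ1 μ2 : FinDist Tm) : Prop :=
  ∃ R, StronglyEquipollent R ∧ DExtensional D R ∧ R μ1 μ2

/-! ## Probabilistic strong bisimulation and lifting -/

/-- Lifting of a relation on processes to distributions, matching the decomposition
`ρ1 = Σ_i p_i δ_{A_i}`, `ρ2 = Σ_i p_i δ_{B_i}` with `A_i R B_i`. -/
def RelLift (R : Tm → Tm → Prop) (ρ1 ρ2 : FinDist Tm) : Prop :=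
  ∃ (k : ℕ) (p : Fin (k+1) → ℝ) (A B : Fin (k+1) → Tm),
    (∀ i, 0 ≤ p i) ∧
    (∀ Q, ρ1.toFun Q = ∑ i, if A i = Q then p i else 0) ∧
    (∀ Q, ρ2.toFun Q = ∑ i, if B i = Q then p i else 0) ∧
    (∀ i, R (A i) (B i))

/-- `R` is a probabilistic strong bisimulation. -/
def IsStrongBisim (R : Tm → Tm → Prop) : Prop :=
  ∀ P Q, R P Q →
    (∀ α ρ, Step P α ρ → ∃ ρ', Step Q α ρ' ∧ RelLift R ρ ρ') ∧
    (∀ α ρ, Step Q α ρ → ∃ ρ', Step P α ρ' ∧ RelLift R ρ ρ')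

/-- `∼p`, the largest probabilistic strong bisimulation. -/
def StrongBisim (P Q : Tm) : Prop := ∃ R, IsStrongBisim R ∧ R P Q

/-- Lifting `E†` of an equivalence on processes to distributions: agreement on the
mass of every equivalence class. -/
def EqLift (E : Tm → Tm → Prop) (μ1 μ2 : FinDist Tm) : Prop :=
  ∀ P, μ1.mass {Q | E P Q} = μ2.mass {Q | E P Q}

/-- The process `Q = Σ_{a∈L} a.0 + Σ_{a∈L} ā.0 + b.0`. -/
noncomputable def testerQ (L : Finset Chan) (b : Chan) : Tm :=
  Tm.sum (2 * L.card)
    (fun i =>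
      if h : (i : ℕ) < L.card then
        Act.inp (L.toList.get ⟨(i : ℕ), by rw [Finset.length_toList]; exact h⟩)
      else if h2 : (i : ℕ) < 2 * L.card then
        Act.out (L.toList.get ⟨(i : ℕ) - L.card, by rw [Finset.length_toList]; omega⟩)
      else Act.inp b)
    (fun _ => Tm.nil)

namespace TesterAux

open FinDist

theorem fd_ext {α : Type} {μ ν : FinDist α} (h : ∀ a, μ.toFun a = ν.toFun a) : μ = ν := by
  cases μ; cases ν
  congr
  exact funext h

/-- Support as a finset. -/
noncomputable def supp {α : Type} (μ : FinDist α) : Finset α := μ.finite_support.toFinset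

theorem mem_supp {α : Type} {μ : FinDist α} {a : α} : a ∈ supp μ ↔ μ.toFun a ≠ 0 := by
  simp [supp]

theorem mass_eq {α : Type} (μ : FinDist α) (S : Set α) (s : Finset α) (h : supp μ ⊆ s) :
    μ.mass S = ∑ a ∈ s, if a ∈ S then μ.toFun a else 0 := by
  unfold mass
  rw [← Finset.sum_filter]
  apply finsum_mem_eq_sum_of_inter_support_eq
  ext a
  simp only [Set.mem_inter_iff, Function.mem_support, Finset.coe_filter, Set.mem_setOf_eq]
  constructor
  · rintro ⟨h1, h2⟩
    exact ⟨⟨h (mem_supp.2 h2), h1⟩, h2⟩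
  · rintro ⟨⟨_, h1⟩, h2⟩
    exact ⟨h1, h2⟩

theorem sum_supp {α : Type} (μ : FinDist α) (s : Finset α) (h : supp μ ⊆ s) :
    ∑ a ∈ s, μ.toFun a = 1 := by
  rw [← μ.sum_one]
  symm
  apply finsum_eq_finset_sum_of_support_subset
  intro a ha
  exact h (mem_supp.2 ha)

theorem mass_nonneg {α : Type} (μ : FinDist α) (S : Set α) : 0 ≤ μ.mass S := by
  rw [mass_eq μ S _ subset_rfl]
  apply Finset.sum_nonneg
  intro a _
  split_ifs
  · exact μ.nonneg a
  · exact le_rfl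

theorem mass_le_one {α : Type} (μ : FinDist α) (S : Set α) : μ.mass S ≤ 1 := by
  rw [mass_eq μ S _ subset_rfl, ← sum_supp μ _ subset_rfl]
  apply Finset.sum_le_sum
  intro a _
  split_ifs
  · exact le_rfl
  · exact μ.nonneg a

theorem mass_zero {α : Type} (μ : FinDist α) (S : Set α) (h : ∀ a, μ.toFun a ≠ 0 → a ∉ S) :
    μ.mass S = 0 := by
  rw [mass_eq μ S _ subset_rfl]
  apply Finset.sum_eq_zero
  intro a ha
  rw [if_neg (h a (mem_supp.1 ha))]

theorem mass_one {α : Type} (μ : FinDist α) (S : Set α) (h : ∀ a, μ.toFun a ≠ 0 → a ∈ S) :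
    μ.mass S = 1 := by
  rw [mass_eq μ S _ subset_rfl, ← sum_supp μ _ subset_rfl]
  apply Finset.sum_congr rfl
  intro a ha
  rw [if_pos (h a (mem_supp.1 ha))]

theorem mass_congr {α : Type} (μ : FinDist α) (S T : Set α)
    (h : ∀ a, μ.toFun a ≠ 0 → (a ∈ S ↔ a ∈ T)) : μ.mass S = μ.mass T := by
  rw [mass_eq μ S _ subset_rfl, mass_eq μ T _ subset_rfl]
  apply Finset.sum_congr rfl
  intro a ha
  simp only [h a (mem_supp.1 ha)]

/-- Effect of a step on masses. -/
theorem mass_step {μ ν ρ : FinDist Tm} {P : Tm} {c : ℝ}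
    (h : ∀ Q, ν.toFun Q = μ.toFun Q + c * (ρ.toFun Q - (if Q = P then 1 else 0))) (S : Set Tm) :
    ν.mass S = μ.mass S + c * (ρ.mass S - (if P ∈ S then 1 else 0)) := by
  let s := supp μ ∪ supp ν ∪ supp ρ ∪ {P}
  have h1 : supp μ ⊆ s := by intro x hx; simp [s, hx]
  have h2 : supp ν ⊆ s := by intro x hx; simp [s, hx]
  have h3 : supp ρ ⊆ s := by intro x hx; simp [s, hx]
  have hP : P ∈ s := by simp [s]
  have h4 : (if P ∈ S then (1:ℝ) else 0) =
      ∑ a ∈ s, if a ∈ S then (if a = P then (1:ℝ) else 0) else 0 := by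
    rw [Finset.sum_eq_single P]
    · simp
    · intro b _ hb; simp [hb]
    · intro hh; exact absurd hP hh
  rw [mass_eq μ S s h1, mass_eq ν S s h2, mass_eq ρ S s h3, h4, ← Finset.sum_sub_distrib,
    Finset.mul_sum, ← Finset.sum_add_distrib]
  apply Finset.sum_congr rfl
  intro a _
  by_cases ha : a ∈ S
  · simp only [ha, if_true]; rw [h a]
  · simp [ha]

theorem exists_step (μ ρ : FinDist Tm) (P : Tm) (c : ℝ) (h0 : 0 ≤ c) (h1 : c ≤ μ.toFun P) :
    ∃ ν : FinDist Tm,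
      ∀ Q, ν.toFun Q = μ.toFun Q + c * (ρ.toFun Q - (if Q = P then 1 else 0)) := by
  let s := supp μ ∪ supp ρ ∪ {P}
  have h1' : supp μ ⊆ s := by intro x hx; simp [s, hx]
  have h3 : supp ρ ⊆ s := by intro x hx; simp [s, hx]
  have hP : P ∈ s := by simp [s]
  have hsub : Function.support
      (fun Q => μ.toFun Q + c * (ρ.toFun Q - (if Q = P then 1 else 0))) ⊆ (s : Set Tm) := by
    intro x hx
    by_contra hn
    apply hx
    have ha : μ.toFun x = 0 := by
      by_contra h; exact hn (h1' (mem_supp.2 h))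
    have hb : ρ.toFun x = 0 := by
      by_contra h; exact hn (h3 (mem_supp.2 h))
    have hc : x ≠ P := by
      rintro rfl; exact hn hP
    simp [ha, hb, hc]
  refine ⟨⟨fun Q => μ.toFun Q + c * (ρ.toFun Q - (if Q = P then 1 else 0)), ?_, ?_, ?_⟩,
    fun Q => rfl⟩
  · intro Q
    have := ρ.nonneg Q
    have := μ.nonneg Q
    have := mul_nonneg h0 (ρ.nonneg Q)
    split_ifs with h
    · subst h; linarith
    · linarith
  · exact s.finite_toSet.subset hsub
  · rw [finsum_eq_finset_sum_of_support_subset _ hsub, Finset.sum_add_distrib, ← Finset.mul_sum,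
      Finset.sum_sub_distrib, sum_supp μ s h1', sum_supp ρ s h3]
    simp [hP]

theorem map_apply {α β : Type} (g : α → β) (hg : Function.Injective g) (μ : FinDist α) (a : α) :
    (μ.map g).toFun (g a) = μ.toFun a := by
  have : {x | g x = g a} = {a} := by
    ext x; simp [hg.eq_iff]
  simp only [FinDist.map, this, finsum_mem_singleton]

theorem map_off {α β : Type} (g : α → β) (μ : FinDist α) (b : β) (h : ∀ a, g a ≠ b) :
    (μ.map g).toFun b = 0 := by
  have : {x | g x = b} = ∅ := by
    ext x; simp [h]
  simp only [FinDist.map, this, finsum_mem_empty]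

theorem par_inj : Function.Injective (fun x : Tm × Tm => Tm.par x.1 x.2) := by
  rintro ⟨a, b⟩ ⟨c, d⟩ h
  simp at h
  simp [h]

theorem parD_apply (μ ν : FinDist Tm) (S T : Tm) :
    (μ.parD ν).toFun (Tm.par S T) = μ.toFun S * ν.toFun T :=
  map_apply _ par_inj (μ.prod ν) (S, T)

theorem parD_ne (μ ν : FinDist Tm) (R : Tm) (h : (μ.parD ν).toFun R ≠ 0) :
    ∃ S T, R = Tm.par S T ∧ μ.toFun S ≠ 0 ∧ ν.toFun T ≠ 0 := by
  by_cases hR : ∃ x : Tm × Tm, Tm.par x.1 x.2 = R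
  · obtain ⟨⟨S, T⟩, rfl⟩ := hR
    rw [parD_apply] at h
    exact ⟨S, T, rfl, (mul_ne_zero_iff.1 h).1, (mul_ne_zero_iff.1 h).2⟩
  · push Not at hR
    exact absurd (map_off _ _ _ hR) h

theorem loc_inj (L : Finset Chan) : Function.Injective (Tm.loc L) := by
  intro a b h
  simpa using h

theorem locD_ne (L : Finset Chan) (μ : FinDist Tm) (R : Tm) (h : (locD L μ).toFun R ≠ 0) :
    ∃ S, R = Tm.loc L S ∧ μ.toFun S ≠ 0 := by
  by_cases hR : ∃ x, Tm.loc L x = R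
  · obtain ⟨S, rfl⟩ := hR
    rw [locD, map_apply _ (loc_inj L)] at h
    exact ⟨S, rfl, h⟩
  · push Not at hR
    exact absurd (map_off _ _ _ hR) h

theorem dirac_ne {α : Type} {P Q : α} (h : (dirac P).toFun Q ≠ 0) : Q = P := by
  by_contra hn
  simp [dirac, hn] at h

/-- `(L)(P|T)`. -/
def E (L : Finset Chan) (T P : Tm) : Tm := Tm.loc L (Tm.par P T)

/-- `(L)(μ|T)`. -/
noncomputable def ED (L : Finset Chan) (T : Tm) (μ : FinDist Tm) : FinDist Tm :=
  locD L (μ.parD (dirac T))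

theorem E_inj {L : Finset Chan} {T T' P P' : Tm} : E L T P = E L T' P' ↔ T = T' ∧ P = P' := by
  simp [E]; tauto

theorem ED_apply (L : Finset Chan) (T : Tm) (μ : FinDist Tm) (P T' : Tm) :
    (ED L T μ).toFun (E L T' P) = if T' = T then μ.toFun P else 0 := by
  rw [ED, E, locD, map_apply _ (loc_inj L), parD_apply]
  simp [dirac]

theorem ED_ne (L : Finset Chan) (T : Tm) (μ : FinDist Tm) (R : Tm)
    (h : (ED L T μ).toFun R ≠ 0) : ∃ P, R = E L T P ∧ μ.toFun P ≠ 0 := by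
  obtain ⟨S0, rfl, h0⟩ := locD_ne _ _ _ h
  obtain ⟨S, T', rfl, h1, h2⟩ := parD_ne _ _ _ h0
  obtain rfl := dirac_ne h2
  exact ⟨S, rfl, h1⟩

/-! Channels -/

theorem chans_subst (P : Tm) (T : Tm) (n : ℕ) :
    (Tm.subst P n T).chans ⊆ T.chans ∪ P.chans := by
  induction T generalizing n with
  | nil => simp [Tm.subst, Tm.chans]
  | var m =>
    simp only [Tm.subst]
    split_ifs <;> simp [Tm.chans]
  | sum k a c ih =>
    intro x hx
    simp only [Tm.subst, Tm.chans, Finset.mem_union, Finset.mem_sup, Finset.mem_univ,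
      true_and] at hx ⊢
    rcases hx with hx | ⟨i, hi⟩
    · exact Or.inl (Or.inl hx)
    · have := ih i n hi
      rw [Finset.mem_union] at this
      rcases this with h | h
      · exact Or.inl (Or.inr ⟨i, h⟩)
      · exact Or.inr h
  | oplus k a c ih =>
    intro x hx
    simp only [Tm.subst, Tm.chans, Finset.mem_union, Finset.mem_sup, Finset.mem_univ,
      true_and] at hx ⊢
    obtain ⟨i, hi⟩ := hx
    have := ih i n hi
    rw [Finset.mem_union] at this
    rcases this with h | h
    · exact Or.inl ⟨i, h⟩
    · exact Or.inr h
  | par S T ihS ihT =>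
    intro x hx
    have h1 := @ihS n x
    have h2 := @ihT n x
    simp only [Tm.subst, Tm.chans, Finset.mem_union] at hx h1 h2 ⊢
    tauto
  | loc L T ih =>
    intro x hx
    have h1 := @ih n x
    simp only [Tm.subst, Tm.chans, Finset.mem_union] at hx h1 ⊢
    tauto
  | fix T ih =>
    intro x hx
    exact ih (n+1) hx

theorem step_chans {P : Tm} {α : Act} {ρ : FinDist Tm} (h : Step P α ρ) :
    α.chans ⊆ P.chans ∧ ∀ Q, ρ.toFun Q ≠ 0 → Q.chans ⊆ P.chans := by
  induction h with
  | choice acts conts i =>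
    constructor
    · intro x hx
      simp only [Tm.chans, Finset.mem_union, Finset.mem_sup, Finset.mem_univ, true_and]
      exact Or.inl ⟨i, hx⟩
    · intro Q hQ x hx
      obtain rfl := dirac_ne hQ
      simp only [Tm.chans, Finset.mem_union, Finset.mem_sup, Finset.mem_univ, true_and]
      exact Or.inr ⟨i, hx⟩
  | oplus w conts ρ hw hρ =>
    constructor
    · simp [Act.chans]
    · intro Q hQ x hx
      rw [hρ] at hQ
      obtain ⟨i, _, hi⟩ := Finset.exists_ne_zero_of_sum_ne_zero hQ
      have : conts i = Q := by
        by_contra hn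
        simp [hn] at hi
      subst this
      simp only [Tm.chans, Finset.mem_sup, Finset.mem_univ, true_and]
      exact ⟨i, hx⟩
  | parL T _ ih =>
    refine ⟨fun x hx => Finset.mem_union_left _ (ih.1 hx), fun Q hQ => ?_⟩
    obtain ⟨S, T', rfl, h1, h2⟩ := parD_ne _ _ _ hQ
    obtain rfl := dirac_ne h2
    exact Finset.union_subset_union (ih.2 _ h1) subset_rfl
  | parR T _ ih =>
    refine ⟨fun x hx => Finset.mem_union_right _ (ih.1 hx), fun Q hQ => ?_⟩
    obtain ⟨S, T', rfl, h1, h2⟩ := parD_ne _ _ _ hQ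
    obtain rfl := dirac_ne h1
    exact Finset.union_subset_union subset_rfl (ih.2 _ h2)
  | comm _ _ _ ih1 ih2 =>
    refine ⟨by simp [Act.chans], fun Q hQ => ?_⟩
    obtain ⟨S, T', rfl, h1, h2⟩ := parD_ne _ _ _ hQ
    exact Finset.union_subset_union (ih1.2 _ h1) (ih2.2 _ h2)
  | loc L _ _ ih =>
    refine ⟨fun x hx => Finset.mem_union_right _ (ih.1 hx), fun Q hQ => ?_⟩
    obtain ⟨S, rfl, h1⟩ := locD_ne _ _ _ hQ
    exact Finset.union_subset_union subset_rfl (ih.2 _ h1)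
  | fixp _ ih =>
    have hs : ∀ T : Tm, (Tm.subst (.fix T) 0 T).chans ⊆ (Tm.fix T).chans := by
      intro T x hx
      have := chans_subst _ _ _ hx
      simpa [Tm.chans] using this
    exact ⟨ih.1.trans (hs _), fun Q hQ => (ih.2 Q hQ).trans (hs _)⟩

/-! The tester -/

theorem tester_inv {L : Finset Chan} {b : Chan} {α : Act} {ρ : FinDist Tm}
    (h : Step (testerQ L b) α ρ) : ρ = dirac Tm.nil ∧ α ≠ Act.tau := by
  unfold testerQ at h
  cases h with
  | choice acts conts i =>
    refine ⟨rfl, ?_⟩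
    dsimp only
    split_ifs <;> simp

theorem tester_b (L : Finset Chan) (b : Chan) :
    Step (testerQ L b) (Act.inp b) (dirac Tm.nil) := by
  have := Step.choice (k := 2 * L.card) (fun i =>
      if h : (i : ℕ) < L.card then
        Act.inp (L.toList.get ⟨(i : ℕ), by rw [Finset.length_toList]; exact h⟩)
      else if h2 : (i : ℕ) < 2 * L.card then
        Act.out (L.toList.get ⟨(i : ℕ) - L.card, by rw [Finset.length_toList]; omega⟩)
      else Act.inp b) (fun _ => Tm.nil) (Fin.last _)
  simp only [Fin.val_last] at this
  rw [dif_neg (by omega), dif_neg (by omega)] at this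
  exact this

theorem tester_inp (L : Finset Chan) (b a : Chan) (ha : a ∈ L) :
    Step (testerQ L b) (Act.inp a) (dirac Tm.nil) := by
  obtain ⟨⟨j, hj⟩, rfl⟩ := List.mem_iff_get.1 (Finset.mem_toList.2 ha)
  have hj' := hj
  rw [Finset.length_toList] at hj'
  have := Step.choice (k := 2 * L.card) (fun i =>
      if h : (i : ℕ) < L.card then
        Act.inp (L.toList.get ⟨(i : ℕ), by rw [Finset.length_toList]; exact h⟩)
      else if h2 : (i : ℕ) < 2 * L.card then
        Act.out (L.toList.get ⟨(i : ℕ) - L.card, by rw [Finset.length_toList]; omega⟩)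
      else Act.inp b) (fun _ => Tm.nil) ⟨j, by omega⟩
  simp only at this
  rw [dif_pos (by omega)] at this
  exact this

theorem tester_out (L : Finset Chan) (b a : Chan) (ha : a ∈ L) :
    Step (testerQ L b) (Act.out a) (dirac Tm.nil) := by
  obtain ⟨⟨j, hj⟩, rfl⟩ := List.mem_iff_get.1 (Finset.mem_toList.2 ha)
  have hj' := hj
  rw [Finset.length_toList] at hj'
  have := Step.choice (k := 2 * L.card) (fun i =>
      if h : (i : ℕ) < L.card then
        Act.inp (L.toList.get ⟨(i : ℕ), by rw [Finset.length_toList]; exact h⟩)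
      else if h2 : (i : ℕ) < 2 * L.card then
        Act.out (L.toList.get ⟨(i : ℕ) - L.card, by rw [Finset.length_toList]; omega⟩)
      else Act.inp b) (fun _ => Tm.nil) ⟨L.card + j, by omega⟩
  simp only at this
  rw [dif_neg (by omega), dif_pos (by omega)] at this
  simp only [Nat.add_sub_cancel_left] at this
  exact this

theorem tester_ne_nil (L : Finset Chan) (b : Chan) : testerQ L b ≠ Tm.nil := by
  simp [testerQ]

theorem alive_psi (L : Finset Chan) (b : Chan) (hb : b ∉ L) (P : Tm) :
    E L (testerQ L b) P ∈ psiL :=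
  ⟨Act.inp b, _, trivial, Step.loc L (Step.parR P (tester_b L b)) hb⟩

/-- A tau step of the alive state. -/
theorem alive_inv {L : Finset Chan} {b : Chan} {P : Tm} (hP : P.chans ⊆ L) {σ : FinDist Tm}
    (h : Step (E L (testerQ L b) P) Act.tau σ) :
    (∃ ρ, Step P Act.tau ρ ∧ σ = ED L (testerQ L b) ρ) ∨
    (∃ ρ, P ∈ psiL ∧ ρ.chansIn L ∧ σ = ED L Tm.nil ρ) := by
  unfold E at h
  cases h with
  | loc _ h ha =>
    generalize hα : Act.tau = α at h
    cases h with
    | parL _ h => subst hα; exact Or.inl ⟨_, h, rfl⟩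
    | parR _ h => exact absurd hα.symm (tester_inv h).2
    | comm hc h1 h2 =>
      right
      obtain ⟨rfl, _⟩ := tester_inv h2
      refine ⟨_, ⟨_, _, ?_, h1⟩, fun Q hQ => ((step_chans h1).2 Q hQ).trans hP, rfl⟩
      obtain ⟨a, ⟨rfl, _⟩ | ⟨rfl, _⟩⟩ := hc <;> trivial

theorem label_blocked {L : Finset Chan} {α : Act} (h : α.chans ⊆ L) (ha : α.Allowed L) :
    ¬ α.IsLabel := by
  cases α <;> simp_all [Act.chans, Act.Allowed, Act.IsLabel]

theorem dead_inv {L : Finset Chan} {P : Tm} (hP : P.chans ⊆ L) {α : Act} {σ : FinDist Tm}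
    (h : Step (E L Tm.nil P) α σ) :
    ¬ α.IsLabel ∧ ∃ ρ, ρ.chansIn L ∧ σ = ED L Tm.nil ρ := by
  unfold E at h
  cases h with
  | loc _ h ha =>
    cases h with
    | parL _ h =>
      exact ⟨label_blocked ((step_chans h).1.trans hP) ha, _,
        fun Q hQ => ((step_chans h).2 Q hQ).trans hP, rfl⟩
    | parR _ h => cases h
    | comm hc h1 h2 => cases h2

/-- Killing step. -/
theorem kill_step {L : Finset Chan} {b : Chan} {P : Tm} (hP : P.chans ⊆ L) (h : P ∈ psiL) :
    ∃ ρ, Step (E L (testerQ L b) P) Act.tau (ED L Tm.nil ρ) := by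
  obtain ⟨α, ρ, hα, hs⟩ := h
  refine ⟨ρ, Step.loc L ?_ trivial⟩
  have hc := (step_chans hs).1.trans hP
  cases α with
  | inp a => exact Step.comm ⟨a, Or.inl ⟨rfl, rfl⟩⟩ hs (tester_out L b a (hc (by simp [Act.chans])))
  | out a => exact Step.comm ⟨a, Or.inr ⟨rfl, rfl⟩⟩ hs (tester_inp L b a (hc (by simp [Act.chans])))
  | tau => exact hα.elim
  | omega => exact hα.elim

/-- Reachable shape. -/
def Valid (L : Finset Chan) (b : Chan) (m : FinDist Tm) : Prop :=
  ∀ R, m.toFun R ≠ 0 → ∃ P, P.chans ⊆ L ∧ (R = E L (testerQ L b) P ∨ R = E L Tm.nil P)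

/-- Alive states. -/
def Alive (L : Finset Chan) (b : Chan) : Set Tm := Set.range (E L (testerQ L b))

theorem dead_not_alive (L : Finset Chan) (b : Chan) (P : Tm) : E L Tm.nil P ∉ Alive L b := by
  rintro ⟨P', h⟩
  exact tester_ne_nil L b (E_inj.1 h).1

theorem valid_mass {L : Finset Chan} {b : Chan} (hb : b ∉ L) {m : FinDist Tm}
    (hm : Valid L b m) : m.mass psiL = m.mass (Alive L b) := by
  apply mass_congr
  intro R hR
  obtain ⟨P, hP, rfl | rfl⟩ := hm R hR
  · exact ⟨fun _ => ⟨P, rfl⟩, fun _ => alive_psi L b hb P⟩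
  · refine ⟨?_, fun h => absurd h (dead_not_alive L b P)⟩
    rintro ⟨α, ρ, hα, hs⟩
    exact absurd hα (dead_inv hP hs).1

theorem valid_ED_alive {L : Finset Chan} {b : Chan} {ρ : FinDist Tm} (h : ρ.chansIn L) :
    Valid L b (ED L (testerQ L b) ρ) := by
  intro R hR
  obtain ⟨P, rfl, hP⟩ := ED_ne _ _ _ _ hR
  exact ⟨P, h P hP, Or.inl rfl⟩

theorem valid_ED_dead {L : Finset Chan} {b : Chan} {ρ : FinDist Tm} (h : ρ.chansIn L) :
    Valid L b (ED L Tm.nil ρ) := by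
  intro R hR
  obtain ⟨P, rfl, hP⟩ := ED_ne _ _ _ _ hR
  exact ⟨P, h P hP, Or.inr rfl⟩

theorem mass_ED_alive (L : Finset Chan) (b : Chan) (ρ : FinDist Tm) :
    (ED L (testerQ L b) ρ).mass (Alive L b) = 1 := by
  apply mass_one
  intro R hR
  obtain ⟨P, rfl, hP⟩ := ED_ne _ _ _ _ hR
  exact ⟨P, rfl⟩

theorem mass_ED_dead (L : Finset Chan) (b : Chan) (ρ : FinDist Tm) :
    (ED L Tm.nil ρ).mass (Alive L b) = 0 := by
  apply mass_zero
  intro R hR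
  obtain ⟨P, rfl, hP⟩ := ED_ne _ _ _ _ hR
  exact dead_not_alive L b P

theorem valid_of_step {L : Finset Chan} {b : Chan} {m m' σ : FinDist Tm} {R : Tm} {c : ℝ}
    (hm : Valid L b m) (hσ : Valid L b σ) (hR : m.toFun R ≠ 0)
    (h : ∀ Q, m'.toFun Q = m.toFun Q + c * (σ.toFun Q - (if Q = R then 1 else 0))) :
    Valid L b m' := by
  intro Q hQ
  by_cases h1 : m.toFun Q = 0
  · by_cases h2 : σ.toFun Q = 0
    · have : Q ≠ R := by rintro rfl; exact hR h1
      rw [h] at hQ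
      simp [h1, h2, this] at hQ
    · exact hσ Q h2
  · exact hm Q h1

/-- The three kinds of target of a step from a valid distribution. -/
theorem step_valid {L : Finset Chan} {b : Chan} {m : FinDist Tm} (hm : Valid L b m) {R : Tm}
    {σ : FinDist Tm} (hR : m.toFun R ≠ 0) (hs : Step R Act.tau σ) :
    (∃ P ρ, R = E L (testerQ L b) P ∧ Step P Act.tau ρ ∧ ρ.chansIn L ∧
      σ = ED L (testerQ L b) ρ) ∨
    (∃ P ρ, R = E L (testerQ L b) P ∧ P ∈ psiL ∧ ρ.chansIn L ∧ σ = ED L Tm.nil ρ) ∨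
    (∃ P ρ, R = E L Tm.nil P ∧ ρ.chansIn L ∧ σ = ED L Tm.nil ρ) := by
  obtain ⟨P, hP, rfl | rfl⟩ := hm R hR
  · rcases alive_inv hP hs with ⟨ρ, h1, h2⟩ | ⟨ρ, h1, h2, h3⟩
    · exact Or.inl ⟨P, ρ, rfl, h1, fun Q hQ => ((step_chans h1).2 Q hQ).trans hP, h2⟩
    · exact Or.inr (Or.inl ⟨P, ρ, rfl, h1, h2, h3⟩)
  · obtain ⟨_, ρ, h1, h2⟩ := dead_inv hP hs
    exact Or.inr (Or.inr ⟨P, ρ, rfl, h1, h2⟩)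

theorem pstep_mono {L : Finset Chan} {b : Chan} {m m' : FinDist Tm} {p : ℝ}
    (hm : Valid L b m) (h : PStep m Act.tau p m') :
    Valid L b m' ∧ m'.mass (Alive L b) ≤ m.mass (Alive L b) := by
  obtain ⟨hp0, hp1, R, σ, hR, hs, h⟩ := h
  have hms := mass_step h (Alive L b)
  have hpos : 0 < m.toFun R * p := mul_pos hR hp0
  rcases step_valid hm hR.ne' hs with ⟨P, ρ, rfl, h1, h2, rfl⟩ | ⟨P, ρ, rfl, h1, h2, rfl⟩ |
    ⟨P, ρ, rfl, h2, rfl⟩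
  · refine ⟨valid_of_step hm (valid_ED_alive h2) hR.ne' h, ?_⟩
    have : E L (testerQ L b) P ∈ Alive L b := ⟨P, rfl⟩
    rw [mass_ED_alive, if_pos this] at hms
    linarith
  · refine ⟨valid_of_step hm (valid_ED_dead h2) hR.ne' h, ?_⟩
    have : E L (testerQ L b) P ∈ Alive L b := ⟨P, rfl⟩
    rw [mass_ED_dead, if_pos this] at hms
    linarith
  · refine ⟨valid_of_step hm (valid_ED_dead h2) hR.ne' h, ?_⟩
    rw [mass_ED_dead, if_neg (dead_not_alive L b P)] at hms
    linarith

theorem internal_refl (m : FinDist Tm) : Internal m m := ⟨[], by simp, rfl⟩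

theorem internal_head {m m' m'' : FinDist Tm} {p : ℝ} (h : PStep m Act.tau p m')
    (h' : Internal m' m'') : Internal m m'' := by
  obtain ⟨π, h1, h2⟩ := h'
  refine ⟨(Act.tau, p) :: π, ?_, m', h, h2⟩
  intro s hs
  rcases List.mem_cons.1 hs with rfl | hs
  · rfl
  · exact h1 s hs

theorem internal_induct {motive : FinDist Tm → Prop} {m m' : FinDist Tm} (h : Internal m m')
    (h0 : motive m) (hstep : ∀ ν ν' p, motive ν → PStep ν Act.tau p ν' → motive ν') :
    motive m' := by
  obtain ⟨π, h1, h2⟩ := h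
  induction π generalizing m with
  | nil => cases h2; exact h0
  | cons s π ih =>
    obtain ⟨ν, hs, h3⟩ := h2
    have := h1 s (by simp)
    rw [this] at hs
    exact ih (hstep _ _ _ h0 hs) (fun t ht => h1 t (by simp [ht])) h3

theorem internal_trans {m m' m'' : FinDist Tm} (h : Internal m m') (h' : Internal m' m'') :
    Internal m m'' := by
  obtain ⟨π, h1, h2⟩ := h
  induction π generalizing m with
  | nil => cases h2; exact h'
  | cons s π ih =>
    obtain ⟨ν, hs, h3⟩ := h2
    have := h1 s (by simp)
    rw [this] at hs
    exact internal_head hs (ih (fun t ht => h1 t (by simp [ht])) h3)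

theorem internal_tail {m m' m'' : FinDist Tm} {p : ℝ} (h' : Internal m m')
    (h : PStep m' Act.tau p m'') : Internal m m'' :=
  internal_trans h' (internal_head h (internal_refl _))

theorem chansIn_step {L : Finset Chan} {μ ν : FinDist Tm} {p : ℝ} (hμ : μ.chansIn L)
    (h : PStep μ Act.tau p ν) : ν.chansIn L := by
  obtain ⟨_, _, P, ρ, hP, hs, h⟩ := h
  intro Q hQ
  by_cases h1 : μ.toFun Q = 0
  · by_cases h2 : ρ.toFun Q = 0
    · have : Q ≠ P := by rintro rfl; exact hP.ne' h1
      rw [h] at hQ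
      simp [h1, h2, this] at hQ
    · exact ((step_chans hs).2 Q h2).trans (hμ P hP.ne')
  · exact hμ Q h1

theorem chiMay_bdd (m : FinDist Tm) : BddAbove {x | ∃ ν, Internal m ν ∧ x = ν.mass psiL} := by
  refine ⟨1, ?_⟩
  rintro x ⟨ν, _, rfl⟩
  exact mass_le_one _ _

theorem le_chiMay {m ν : FinDist Tm} (h : Internal m ν) : ν.mass psiL ≤ chiMayL m :=
  le_csSup (chiMay_bdd m) ⟨ν, h, rfl⟩

theorem chiMay_le {m : FinDist Tm} {x : ℝ} (h : ∀ ν, Internal m ν → ν.mass psiL ≤ x) :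
    chiMayL m ≤ x := by
  apply csSup_le
  · exact ⟨_, m, internal_refl m, rfl⟩
  · rintro y ⟨ν, hν, rfl⟩
    exact h ν hν

theorem chiMay_valid {L : Finset Chan} {b : Chan} (hb : b ∉ L) {m : FinDist Tm}
    (hm : Valid L b m) : chiMayL m = m.mass (Alive L b) := by
  apply le_antisymm
  · apply chiMay_le
    intro ν hν
    have : Valid L b ν ∧ ν.mass (Alive L b) ≤ m.mass (Alive L b) := by
      refine internal_induct (motive := fun ν => Valid L b ν ∧
        ν.mass (Alive L b) ≤ m.mass (Alive L b)) hν ⟨hm, le_rfl⟩ ?_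
      intro ν ν' p h h'
      obtain ⟨h1, h2⟩ := pstep_mono h.1 h'
      exact ⟨h1, h2.trans h.2⟩
    rw [valid_mass hb this.1]
    exact this.2
  · rw [← valid_mass hb hm]
    exact le_chiMay (internal_refl m)

theorem chiFair_le {m ν : FinDist Tm} (h : Internal m ν) : chiFairL m ≤ chiMayL ν := by
  refine csInf_le ⟨0, ?_⟩ ⟨ν, h, rfl⟩
  rintro x ⟨ν, _, rfl⟩
  exact (mass_nonneg ν psiL).trans (le_chiMay (internal_refl ν))

theorem le_chiFair {m : FinDist Tm} {x : ℝ} (h : ∀ ν, Internal m ν → x ≤ chiMayL ν) :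
    x ≤ chiFairL m := by
  apply le_csInf
  · exact ⟨_, m, internal_refl m, rfl⟩
  · rintro y ⟨ν, hν, rfl⟩
    exact h ν hν

/-- Lifting steps of `μ` to `(L)(μ|T)`. -/
theorem lift_step {L : Finset Chan} {T : Tm} {μ ν : FinDist Tm} {p : ℝ}
    (h : PStep μ Act.tau p ν) : PStep (ED L T μ) Act.tau p (ED L T ν) := by
  obtain ⟨hp0, hp1, P, ρ, hP, hs, h⟩ := h
  refine ⟨hp0, hp1, E L T P, ED L T ρ, ?_, Step.loc L (Step.parL T hs) trivial, ?_⟩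
  · rw [ED_apply, if_pos rfl]; exact hP
  · intro R
    by_cases hR : ∃ P', R = E L T P'
    · obtain ⟨P', rfl⟩ := hR
      simp only [ED_apply, if_true, E_inj, true_and]
      exact h P'
    · have h0 : ∀ κ : FinDist Tm, (ED L T κ).toFun R = 0 := by
        intro κ
        by_contra hn
        obtain ⟨P', h1, _⟩ := ED_ne _ _ _ _ hn
        exact hR ⟨P', h1⟩
      have h1 : R ≠ E L T P := fun h => hR ⟨P, h⟩
      simp [h0, h1]

theorem kill_all {L : Finset Chan} {b : Chan} {ν : FinDist Tm} (hν : ν.chansIn L)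
    (s : Finset Tm) (hs : ∀ P ∈ s, P ∈ psiL ∧ ν.toFun P ≠ 0) :
    ∃ m, Internal (ED L (testerQ L b) ν) m ∧ Valid L b m ∧
      (∀ P, P ∉ s → m.toFun (E L (testerQ L b) P) = ν.toFun P) ∧
      m.mass (Alive L b) = 1 - ∑ P ∈ s, ν.toFun P := by
  induction s using Finset.induction_on with
  | empty =>
    refine ⟨_, internal_refl _, valid_ED_alive hν, ?_, ?_⟩
    · intro P _; rw [ED_apply, if_pos rfl]
    · rw [mass_ED_alive]; simp
  | insert P s hPs ih =>
    obtain ⟨m, h1, h2, h3, h4⟩ := ih (fun Q hQ => hs Q (Finset.mem_insert_of_mem hQ))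
    obtain ⟨hP1, hP2⟩ := hs P (Finset.mem_insert_self _ _)
    have hmP := h3 P hPs
    have hpos : 0 < m.toFun (E L (testerQ L b) P) := by
      rw [hmP]; exact lt_of_le_of_ne (ν.nonneg P) hP2.symm
    obtain ⟨ρ, hst⟩ := kill_step (b := b) (hν P hP2) hP1
    obtain ⟨m', hm'⟩ := exists_step m (ED L Tm.nil ρ) (E L (testerQ L b) P)
      (m.toFun (E L (testerQ L b) P) * 1) (by linarith) (by linarith)
    have hstep : PStep m Act.tau 1 m' := ⟨one_pos, le_rfl, _, _, hpos, hst, hm'⟩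
    refine ⟨m', internal_tail h1 hstep, (pstep_mono h2 hstep).1, ?_, ?_⟩
    · intro Q hQ
      rw [Finset.mem_insert, not_or] at hQ
      rw [hm', h3 Q hQ.2, ED_apply, if_neg (tester_ne_nil L b), if_neg]
      · simp
      · intro h; exact hQ.1 (E_inj.1 h).2
    · have := mass_step hm' (Alive L b)
      have hin : E L (testerQ L b) P ∈ Alive L b := ⟨P, rfl⟩
      rw [mass_ED_dead, if_pos hin, h4, hmP] at this
      rw [this, Finset.sum_insert hPs]
      ring

/-- Simulation relation for the converse direction. -/
def Sim (L : Finset Chan) (b : Chan) (m ν : FinDist Tm) : Prop :=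
  Valid L b m ∧ ∀ P, m.toFun (E L (testerQ L b) P) ≤ ν.toFun P ∧
    (m.toFun (E L (testerQ L b) P) ≠ ν.toFun P → P ∈ psiL)

theorem sim_step {L : Finset Chan} {b : Chan} {m m' ν : FinDist Tm} {p : ℝ}
    (hs : Sim L b m ν) (h : PStep m Act.tau p m') :
    ∃ ν', Internal ν ν' ∧ Sim L b m' ν' := by
  have hv := (pstep_mono hs.1 h).1
  obtain ⟨hp0, hp1, R, σ, hR, hst, h⟩ := h
  have hpos : 0 < m.toFun R * p := mul_pos hR hp0
  have hle : m.toFun R * p ≤ m.toFun R := by nlinarith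
  rcases step_valid hs.1 hR.ne' hst with ⟨P, ρ, rfl, h1, h2, rfl⟩ | ⟨P, ρ, rfl, h1, h2, rfl⟩ |
    ⟨P, ρ, rfl, h2, rfl⟩
  · have hνP := (hs.2 P).1
    have hν0 : 0 < ν.toFun P := hR.trans_le hνP
    obtain ⟨ν', hν'⟩ := exists_step ν ρ P _ hpos.le (hle.trans hνP)
    refine ⟨ν', internal_head (p := m.toFun (E L (testerQ L b) P) * p / ν.toFun P)
      ⟨by positivity, ?_, P, ρ, hν0, h1, ?_⟩ (internal_refl _), hv, ?_⟩
    · rw [div_le_one hν0]; exact hle.trans hνP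
    · intro Q
      rw [hν', mul_div_cancel₀ _ hν0.ne']
    · intro Q
      rw [h, hν', ED_apply, if_pos rfl]
      simp only [E_inj, true_and]
      refine ⟨by linarith [(hs.2 Q).1], fun hne => (hs.2 Q).2 fun he => hne (by rw [he])⟩
  · refine ⟨ν, internal_refl _, hv, ?_⟩
    intro Q
    rw [h, ED_apply, if_neg (tester_ne_nil L b)]
    simp only [E_inj, true_and]
    by_cases hQ : Q = P
    · subst hQ
      refine ⟨?_, fun _ => h1⟩
      rw [if_pos rfl]
      linarith [(hs.2 Q).1]
    · rw [if_neg hQ]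
      simpa using hs.2 Q
  · refine ⟨ν, internal_refl _, hv, ?_⟩
    intro Q
    rw [h, ED_apply, if_neg (tester_ne_nil L b), if_neg]
    · simpa using hs.2 Q
    · intro h; exact tester_ne_nil L b (E_inj.1 h).1

theorem sim_mass {L : Finset Chan} {b : Chan} {m ν : FinDist Tm} (hs : Sim L b m ν) :
    1 ≤ ν.mass psiL + m.mass (Alive L b) := by
  have hinj : Function.Injective (E L (testerQ L b)) := fun P P' h => (E_inj.1 h).2
  rw [mass_eq ν psiL _ subset_rfl,
    mass_eq m (Alive L b) (supp m ∪ (supp ν).image (E L (testerQ L b))) Finset.subset_union_left,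
    ← sum_supp ν _ subset_rfl]
  have key : ∑ P ∈ supp ν, m.toFun (E L (testerQ L b) P) ≤
      ∑ a ∈ supp m ∪ (supp ν).image (E L (testerQ L b)),
        if a ∈ Alive L b then m.toFun a else 0 := by
    have : ∑ P ∈ supp ν, m.toFun (E L (testerQ L b) P) =
        ∑ a ∈ (supp ν).image (E L (testerQ L b)), if a ∈ Alive L b then m.toFun a else 0 := by
      rw [Finset.sum_image hinj.injOn]
      apply Finset.sum_congr rfl
      intro P _
      rw [if_pos ⟨P, rfl⟩]
    rw [this]
    apply Finset.sum_le_sum_of_subset_of_nonneg Finset.subset_union_right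
    intro a _ _
    split_ifs
    · exact m.nonneg a
    · exact le_rfl
  refine le_trans ?_ (add_le_add_right key _)
  rw [← Finset.sum_add_distrib]
  apply Finset.sum_le_sum
  intro P _
  split_ifs with hP
  · linarith [m.nonneg (E L (testerQ L b) P)]
  · have : m.toFun (E L (testerQ L b) P) = ν.toFun P := by
      by_contra hn; exact hP ((hs.2 P).2 hn)
    linarith

theorem main (μ : FinDist Tm) (L : Finset Chan) (hL : μ.chansIn L) (b : Chan) (hb : b ∉ L) :
    chiMayL μ + chiFairL (ED L (testerQ L b) μ) = 1 := by
  apply le_antisymm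
  · suffices h : chiMayL μ ≤ 1 - chiFairL (ED L (testerQ L b) μ) by linarith
    apply chiMay_le
    intro ν hν
    obtain ⟨hc, hi⟩ : ν.chansIn L ∧ Internal (ED L (testerQ L b) μ) (ED L (testerQ L b) ν) := by
      refine internal_induct (motive := fun ν => ν.chansIn L ∧
        Internal (ED L (testerQ L b) μ) (ED L (testerQ L b) ν)) hν ⟨hL, internal_refl _⟩ ?_
      intro ν ν' p h h'
      exact ⟨chansIn_step h.1 h', internal_tail h.2 (lift_step h')⟩
    obtain ⟨m, h1, h2, _, h4⟩ := kill_all (b := b) hc ((supp ν).filter (· ∈ psiL))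
      (fun P hP => ⟨(Finset.mem_filter.1 hP).2, mem_supp.1 (Finset.mem_filter.1 hP).1⟩)
    have := chiFair_le (internal_trans hi h1)
    rw [chiMay_valid hb h2, h4, Finset.sum_filter, ← mass_eq ν psiL _ subset_rfl] at this
    linarith
  · suffices h : 1 - chiMayL μ ≤ chiFairL (ED L (testerQ L b) μ) by linarith
    apply le_chiFair
    intro m hm
    obtain ⟨ν, hν, hs⟩ : ∃ ν, Internal μ ν ∧ Sim L b m ν := by
      refine internal_induct (motive := fun m => ∃ ν, Internal μ ν ∧ Sim L b m ν) hm
        ⟨μ, internal_refl _, valid_ED_alive hL, ?_⟩ ?_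
      · intro P
        rw [ED_apply, if_pos rfl]
        exact ⟨le_rfl, fun h => absurd rfl h⟩
      · rintro m m' p ⟨ν, hν, hs⟩ h'
        obtain ⟨ν', h1, h2⟩ := sim_step hs h'
        exact ⟨ν', internal_trans hν h1, h2⟩
    rw [chiMay_valid hb hs.1]
    have := sim_mass hs
    have := le_chiMay hν
    linarith

end TesterAux

/-- For `μ ∈ D(P_RCCS)` with channels contained in the finite set
`L` and a fresh channel `b ∉ L`, with `μ^L = (L)(μ | δ_Q)`, one has
`χmay_𝓛(μ) + χfair_𝓛(μ^L) = 1`. -/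
theorem chiMay_add_chiFair_tester_eq_one
    (μ : FinDist Tm) (hμ : μ.IsProcDist)
    (L : Finset Chan) (hL : μ.chansIn L) (b : Chan) (hb : b ∉ L) :
    chiMayL μ +
      chiFairL (FinDist.locD L (μ.parD (FinDist.dirac (testerQ L b)))) = 1 := by
  exact TesterAux.main μ L hL b hb
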